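/- arXiv:math/0703568 — 2 statements merged into one kernel-verified Lean document; each statement's English description precedes it below -/
import Mathlib

section
/- In the preprojective algebra Π(E_8), the element z_12 = a_1a_2a_3x_6x_4x_6a_3^*a_2^*a_1^* + a_2a_3x_4x_3^2x_4a_3^*a_2^* + a_3(x_4x_6)^2x_4a_3^* + (x_3x_4x_3)^2 − a_4(x_6x_4)^2x_6a_4^* + a_5a_4x_6x_4^2x_6a_4^*a_5^* − a_6(x_4x_6)^2x_4a_6^* lies in the center of Π(E_8), i.e. z_12·y = y·z_12 for all y ∈ Π(E_8). -/
/-- Generators of the preprojective algebra of `E₈`: idempotents `e i` for the eight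
vertices, arrows `a i` and reversed arrows `astar i` for the seven edges
(arrows are indexed `a₀, a₁, …, a₆`). -/
inductive E8Gen : Type
  | e : Fin 8 → E8Gen
  | a : Fin 7 → E8Gen
  | astar : Fin 7 → E8Gen

namespace E8

/-- The trivial-path generators inside the free algebra. -/
noncomputable def E (i : Fin 8) : FreeAlgebra ℂ E8Gen := FreeAlgebra.ι ℂ (E8Gen.e i)

/-- The arrow generators inside the free algebra (`A i` is the arrow `aᵢ`). -/
noncomputable def A (i : Fin 7) : FreeAlgebra ℂ E8Gen := FreeAlgebra.ι ℂ (E8Gen.a i)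

/-- The reversed-arrow generators inside the free algebra (`S i` is `aᵢ*`). -/
noncomputable def S (i : Fin 7) : FreeAlgebra ℂ E8Gen := FreeAlgebra.ι ℂ (E8Gen.astar i)

/-- Sources of the arrows `a₀ : 1 → 2`, `a₁ : 2 → 3`, `a₂ : 3 → 4`, `a₃ : 4 → 5`,
`a₄ : 6 → 5`, `a₅ : 7 → 6`, `a₆ : 8 → 5` (vertices are `0`-indexed). -/
def src : Fin 7 → Fin 8 := ![0, 1, 2, 3, 5, 6, 7]

/-- Targets of the arrows of the `E₈` quiver (vertices are `0`-indexed). -/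
def tgt : Fin 7 → Fin 8 := ![1, 2, 3, 4, 4, 5, 4]

/-- The defining relations of the preprojective algebra `Π(E₈)`. -/
inductive Rel : FreeAlgebra ℂ E8Gen → FreeAlgebra ℂ E8Gen → Prop
  | orth (i j : Fin 8) : Rel (E i * E j) (if i = j then E i else 0)
  | sum_eq_one : Rel (∑ i, E i) 1
  | arrow_left (i : Fin 7) : Rel (E (src i) * A i) (A i)
  | arrow_right (i : Fin 7) : Rel (A i * E (tgt i)) (A i)
  | star_left (i : Fin 7) : Rel (E (tgt i) * S i) (S i)
  | star_right (i : Fin 7) : Rel (S i * E (src i)) (S i)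
  | preproj : Rel (∑ i, (A i * S i - S i * A i)) 0

end E8

/-- The preprojective algebra `Π(E₈)`: the quotient of the free `ℂ`-algebra on the
generators by the two-sided ideal generated by the defining relations. -/
abbrev PiE8 : Type := RingQuot E8.Rel

/-- The arrow `aᵢ` in `Π(E₈)` (`pa 0 = a₀`, …, `pa 6 = a₆`). -/
noncomputable def pa (i : Fin 7) : PiE8 := RingQuot.mkAlgHom ℂ E8.Rel (E8.A i)

/-- The reversed arrow `aᵢ*` in `Π(E₈)`. -/
noncomputable def ps (i : Fin 7) : PiE8 := RingQuot.mkAlgHom ℂ E8.Rel (E8.S i)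

/-- The element `xᵢ = aᵢ* aᵢ` in `Π(E₈)` (`px 0 = x₀`, …, `px 6 = x₆`). -/
noncomputable def px (i : Fin 7) : PiE8 := ps i * pa i

/-- `z₁₂ = a₁a₂a₃x₆x₄x₆a₃*a₂*a₁* + a₂a₃x₄x₃²x₄a₃*a₂* + a₃(x₄x₆)²x₄a₃* + (x₃x₄x₃)²
    − a₄(x₆x₄)²x₆a₄* + a₅a₄x₆x₄²x₆a₄*a₅* − a₆(x₄x₆)²x₄a₆*`. -/
noncomputable def z12 : PiE8 :=
  pa 1 * pa 2 * pa 3 * px 6 * px 4 * px 6 * ps 3 * ps 2 * ps 1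
    + pa 2 * pa 3 * px 4 * px 3 ^ 2 * px 4 * ps 3 * ps 2
    + pa 3 * (px 4 * px 6) ^ 2 * px 4 * ps 3
    + (px 3 * px 4 * px 3) ^ 2
    - pa 4 * (px 6 * px 4) ^ 2 * px 6 * ps 4
    + pa 5 * pa 4 * px 6 * px 4 ^ 2 * px 6 * ps 4 * ps 5
    - pa 6 * (px 4 * px 6) ^ 2 * px 4 * ps 6

/-- `z₂₀ = −a₁a₂a₃x₄²x₃³x₄²a₃*a₂*a₁* − a₂a₃(x₆x₄)²(x₄x₆)²a₃*a₂* + a₃(x₆x₄)⁴x₆a₃*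
    − (x₄x₆)⁵ + (x₆x₄²)³x₆ − (x₆x₄)⁵ − a₄(x₄x₆x₄)³a₄* − a₆(x₄x₆)⁴x₄a₆*`. -/
noncomputable def z20 : PiE8 :=
  -(pa 1 * pa 2 * pa 3 * px 4 ^ 2 * px 3 ^ 3 * px 4 ^ 2 * ps 3 * ps 2 * ps 1)
    - pa 2 * pa 3 * (px 6 * px 4) ^ 2 * (px 4 * px 6) ^ 2 * ps 3 * ps 2
    + pa 3 * (px 6 * px 4) ^ 4 * px 6 * ps 3
    - (px 4 * px 6) ^ 5 + (px 6 * px 4 ^ 2) ^ 3 * px 6 - (px 6 * px 4) ^ 5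
    - pa 4 * (px 4 * px 6 * px 4) ^ 3 * ps 4
    - pa 6 * (px 4 * px 6) ^ 4 * px 4 * ps 6

namespace E8

section Words

variable {R : Type*} [Ring R] {p q x : R}

/- Identities between the loops `p = x₄`, `q = x₆`, `x = x₃` at the branching vertex; the one
named after `i` expresses that `z₁₂` commutes with the arrow `aᵢ`. -/

theorem loop_word_zero (hx : x = -(p + q)) (hp : p * p * p = 0) (hq : q * q = 0) :
    q * p * q = -(p * x ^ 2) - x * (p * q + q * p) := by
  have hp' : p * (p * p) = 0 := by rw [← mul_assoc, hp]
  have hqw (w : R) : q * (q * w) = 0 := by rw [← mul_assoc, hq, zero_mul]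
  subst hx
  simp only [pow_succ, pow_zero, one_mul, mul_add, add_mul, neg_mul, mul_neg, neg_neg, mul_assoc,
    hp', hq, hqw, mul_zero]
  abel

theorem loop_word_one (hx : x = -(p + q)) (hp : p * p * p = 0) (hq : q * q = 0) :
    q * p * q * x - p * x ^ 2 * p = -(x ^ 2 * (p * p + q * p)) := by
  have hp' : p * (p * p) = 0 := by rw [← mul_assoc, hp]
  have hqw (w : R) : q * (q * w) = 0 := by rw [← mul_assoc, hq, zero_mul]
  subst hx
  simp only [pow_succ, pow_zero, one_mul, mul_add, add_mul, neg_mul, mul_neg, mul_assoc,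
    hp', hq, hqw, mul_zero, zero_mul]
  abel

theorem loop_word_two (hx : x = -(p + q)) (hp : p * p * p = 0) (hq : q * q = 0) :
    p * x ^ 2 * p * x - (p * q) ^ 2 * p = -(p * x ^ 4) := by
  have hp' : p * (p * p) = 0 := by rw [← mul_assoc, hp]
  have hpw (w : R) : p * (p * (p * w)) = 0 := by rw [← mul_assoc, ← mul_assoc, hp, zero_mul]
  subst hx
  simp only [pow_succ, pow_zero, one_mul, mul_add, add_mul, neg_mul, mul_neg, neg_neg, mul_assoc,
    hp', hpw, hq, mul_zero, zero_mul]
  abel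

theorem loop_word_three (hx : x = -(p + q)) (hp : p * p * p = 0) (hq : q * q = 0) :
    (p * q) ^ 2 * p * x - (x * p * x) ^ 2 = -(x ^ 4 * (p * p + p * q)) := by
  have hp' : p * (p * p) = 0 := by rw [← mul_assoc, hp]
  have hpw (w : R) : p * (p * (p * w)) = 0 := by rw [← mul_assoc, ← mul_assoc, hp, zero_mul]
  have hqw (w : R) : q * (q * w) = 0 := by rw [← mul_assoc, hq, zero_mul]
  subst hx
  simp only [pow_succ, pow_zero, one_mul, mul_add, add_mul, neg_mul, mul_neg, mul_assoc,
    hp', hpw, hq, hqw, mul_zero, zero_mul]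
  abel

theorem loop_word_four (hx : x = -(p + q)) (hp : p * p * p = 0) (hq : q * q = 0) :
    (q * p) ^ 3 + (x * p * x) ^ 2 =
      p * p * (q * p * p * q) + p * x ^ 5 - x ^ 5 * p - x ^ 5 * q := by
  have hp' : p * (p * p) = 0 := by rw [← mul_assoc, hp]
  have hpw (w : R) : p * (p * (p * w)) = 0 := by rw [← mul_assoc, ← mul_assoc, hp, zero_mul]
  have hqw (w : R) : q * (q * w) = 0 := by rw [← mul_assoc, hq, zero_mul]
  subst hx
  simp only [pow_succ, pow_zero, one_mul, mul_add, add_mul, neg_mul, mul_neg, mul_assoc,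
    hp', hpw, hq, hqw, mul_zero, zero_mul]
  abel

theorem loop_word_five (hx : x = -(p + q)) (hp : p * p * p = 0) (hq : q * q = 0) :
    q * p ^ 2 * q * p + (q * p) ^ 2 * q =
      -(x ^ 5) - p * (p * q * p * p + p * q * p * q + q * p * p * q + q * p * q * p)
        - q * p * q * (p * p) := by
  have hp' : p * (p * p) = 0 := by rw [← mul_assoc, hp]
  subst hx
  simp only [pow_succ, pow_zero, one_mul, mul_add, add_mul, neg_mul, mul_neg, neg_neg, mul_assoc,
    hp', hq, mul_zero, zero_mul]
  abel

theorem loop_word_six (hx : x = -(p + q)) (hp : p * p * p = 0) (hq : q * q = 0) :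
    (p * q) ^ 3 + (x * p * x) ^ 2 = q * (p * p * q * p * p) - x ^ 5 * q := by
  have hp' : p * (p * p) = 0 := by rw [← mul_assoc, hp]
  have hpw (w : R) : p * (p * (p * w)) = 0 := by rw [← mul_assoc, ← mul_assoc, hp, zero_mul]
  have hqw (w : R) : q * (q * w) = 0 := by rw [← mul_assoc, hq, zero_mul]
  subst hx
  simp only [pow_succ, pow_zero, one_mul, mul_add, add_mul, neg_mul, mul_neg, mul_assoc,
    hp', hpw, hq, hqw, mul_zero, zero_mul]
  abel

end Words

/-- The preprojective relations of `E₈`, one for each vertex. -/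
structure VertexRelations {R : Type*} [Ring R] (a s : Fin 7 → R) : Prop where
  v0 : a 0 * s 0 = 0
  v1 : a 1 * s 1 = s 0 * a 0
  v2 : a 2 * s 2 = s 1 * a 1
  v3 : a 3 * s 3 = s 2 * a 2
  v4 : s 3 * a 3 = -(s 4 * a 4 + s 6 * a 6)
  v5 : a 4 * s 4 = s 5 * a 5
  v6 : a 5 * s 5 = 0
  v7 : a 6 * s 6 = 0

/-- The summand of `z₁₂` at each vertex. -/
def component {R : Type*} [Ring R] (a s : Fin 7 → R) : Fin 8 → R :=
  let x i := s i * a i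
  ![0,
    a 1 * a 2 * a 3 * x 6 * x 4 * x 6 * s 3 * s 2 * s 1,
    a 2 * a 3 * x 4 * x 3 ^ 2 * x 4 * s 3 * s 2,
    a 3 * (x 4 * x 6) ^ 2 * x 4 * s 3,
    (x 3 * x 4 * x 3) ^ 2,
    -(a 4 * (x 6 * x 4) ^ 2 * x 6 * s 4),
    a 5 * a 4 * x 6 * x 4 ^ 2 * x 6 * s 4 * s 5,
    -(a 6 * (x 4 * x 6) ^ 2 * x 4 * s 6)]

section Component

open MulOpposite

variable {R : Type*} [Ring R]

theorem component_op (a s : Fin 7 → R) (v : Fin 8) :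
    component (fun i => op (s i)) (fun i => op (a i)) v = op (component a s v) := by
  fin_cases v <;>
    simp [component, pow_succ, mul_assoc]

theorem mul_component {a s : Fin 7 → R} {e : Fin 8 → R} (ha : ∀ i, e (src i) * a i = a i)
    (hs : ∀ i, e (tgt i) * s i = s i) (v : Fin 8) : e v * component a s v = component a s v := by
  have ha' (i : Fin 7) (v : Fin 8) (hv : src i = v) (w : R) : e v * (a i * w) = a i * w := by
    rw [← hv, ← mul_assoc, ha]
  have hs' (w : R) : e 4 * (s 3 * w) = s 3 * w := by
    rw [← mul_assoc]
    exact congr($(hs 3) * w)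
  fin_cases v
  · simp [component]
  · simp [component, mul_assoc, ha' 1 1 rfl]
  · simp [component, mul_assoc, ha' 2 2 rfl]
  · simp [component, mul_assoc, ha' 3 3 rfl]
  · simp [component, mul_assoc, pow_succ, hs']
  · simp [component, mul_assoc, ha' 4 5 rfl]
  · simp [component, mul_assoc, ha' 5 6 rfl]
  · simp [component, mul_assoc, ha' 6 7 rfl]

theorem component_mul {a s : Fin 7 → R} {e : Fin 8 → R} (hs : ∀ i, s i * e (src i) = s i)
    (ha : ∀ i, a i * e (tgt i) = a i) (v : Fin 8) : component a s v * e v = component a s v := by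
  apply op_injective
  rw [op_mul, ← component_op]
  exact mul_component (e := fun v => op (e v)) (fun i => congr(op $(hs i)))
    (fun i => congr(op $(ha i))) v

end Component

namespace VertexRelations

open MulOpposite

variable {R : Type*} [Ring R] {a s : Fin 7 → R}

/-- Reversal of paths preserves the preprojective relations. -/
protected theorem op (h : VertexRelations a s) :
    VertexRelations (fun i => op (s i)) (fun i => op (a i)) := by
  constructor <;>
    simp only [← op_mul, ← op_add, ← op_neg, h.v0, h.v1, h.v2, h.v3, h.v4, h.v5, h.v6, h.v7, op_zero]

theorem arm_shift_three (h : VertexRelations a s) :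
    a 3 * (s 3 * a 3) = s 2 * a 2 * a 3 := by
  rw [← mul_assoc, h.v3]

theorem arm_shift_two (h : VertexRelations a s) :
    a 2 * (s 2 * a 2) = s 1 * a 1 * a 2 := by
  rw [← mul_assoc, h.v2]

theorem arm_shift_one (h : VertexRelations a s) :
    a 1 * (s 1 * a 1) = s 0 * a 0 * a 1 := by
  rw [← mul_assoc, h.v1]

theorem a_one_sq (h : VertexRelations a s) : a 1 * (s 1 * a 1) ^ 2 = 0 := by
  rw [pow_two, ← mul_assoc, h.arm_shift_one, mul_assoc, h.arm_shift_one]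
  simp only [mul_assoc]
  rw [← mul_assoc (a 0), h.v0, zero_mul, mul_zero]

theorem a_two_cube (h : VertexRelations a s) : a 2 * (s 2 * a 2) ^ 3 = 0 := by
  have : SemiconjBy (a 2) (s 2 * a 2) (s 1 * a 1) := h.arm_shift_two
  rw [(this.pow_right 3).eq, pow_succ', mul_assoc (s 1), h.a_one_sq, mul_zero, zero_mul]

theorem a_three_pow_four (h : VertexRelations a s) : a 3 * (s 3 * a 3) ^ 4 = 0 := by
  have : SemiconjBy (a 3) (s 3 * a 3) (s 2 * a 2) := h.arm_shift_three
  rw [(this.pow_right 4).eq, pow_succ', mul_assoc (s 2), h.a_two_cube, mul_zero, zero_mul]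

theorem semiconj_path_two (h : VertexRelations a s) :
    SemiconjBy (a 2 * a 3) (s 3 * a 3) (s 1 * a 1) :=
  SemiconjBy.mul_left (y := s 2 * a 2) h.arm_shift_two h.arm_shift_three

theorem path_three_sq (h : VertexRelations a s) : a 1 * a 2 * a 3 * (s 3 * a 3) ^ 2 = 0 := by
  rw [mul_assoc (a 1), mul_assoc (a 1), (h.semiconj_path_two.pow_right 2).eq, ← mul_assoc,
    h.a_one_sq, zero_mul]

theorem path_four (h : VertexRelations a s) : a 0 * a 1 * a 2 * a 3 * (s 3 * a 3) = 0 := by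
  rw [mul_assoc _ (a 2), mul_assoc, h.semiconj_path_two.eq, mul_assoc (a 0), ← mul_assoc (a 1),
    h.arm_shift_one]
  simp only [← mul_assoc, h.v0, zero_mul]

theorem x_three_pow_five (h : VertexRelations a s) : (s 3 * a 3) ^ 5 = 0 := by
  rw [pow_succ', mul_assoc, h.a_three_pow_four, mul_zero]

theorem a_four_sq (h : VertexRelations a s) : a 4 * (s 4 * a 4 * (s 4 * a 4)) = 0 := by
  have : SemiconjBy (a 4) (s 4 * a 4) (s 5 * a 5) := by
    rw [SemiconjBy, ← mul_assoc, h.v5]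
  rw [← pow_two, (this.pow_right 2).eq, pow_two, mul_assoc (s 5), ← mul_assoc (a 5), h.v6,
    zero_mul, mul_zero, zero_mul]

theorem path_five (h : VertexRelations a s) : a 5 * a 4 * (s 4 * a 4) = 0 := by
  rw [mul_assoc, ← mul_assoc (a 4), h.v5]
  simp only [← mul_assoc, h.v6, zero_mul]

theorem x_four_cube (h : VertexRelations a s) : s 4 * a 4 * (s 4 * a 4) * (s 4 * a 4) = 0 := by
  rw [mul_assoc, mul_assoc, h.a_four_sq, mul_zero]

theorem a_six_x (h : VertexRelations a s) : a 6 * (s 6 * a 6) = 0 := by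
  rw [← mul_assoc, h.v7, zero_mul]

theorem x_six_sq (h : VertexRelations a s) : s 6 * a 6 * (s 6 * a 6) = 0 := by
  rw [mul_assoc, h.a_six_x, mul_zero]

theorem x_three_sq_mul_path (h : VertexRelations a s) :
    (s 3 * a 3) ^ 2 * (s 3 * (s 2 * s 1)) = 0 := by
  apply op_injective
  simpa [mul_assoc] using h.op.path_three_sq

theorem x_three_pow_four_mul (h : VertexRelations a s) : (s 3 * a 3) ^ 4 * s 3 = 0 := by
  apply op_injective
  simpa using h.op.a_three_pow_four

theorem x_four_sq_mul (h : VertexRelations a s) : s 4 * a 4 * (s 4 * a 4) * s 4 = 0 := by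
  apply op_injective
  simpa using h.op.a_four_sq

theorem component_mul_arrow (h : VertexRelations a s) (i : Fin 7) :
    component a s (src i) * a i = a i * component a s (tgt i) := by
  have hp := h.x_four_cube
  have hq := h.x_six_sq
  have h5 := h.x_three_pow_five
  fin_cases i
  · have key := congr(a 0 * a 1 * a 2 * a 3 * $(loop_word_zero h.v4 hp hq) * (s 3 * (s 2 * s 1)))
    rw [mul_sub, sub_mul, ← mul_assoc _ (s 3 * a 3) (_ + _), h.path_four, mul_neg, neg_mul,
      mul_assoc _ (_ * _ ^ 2), mul_assoc (s 4 * a 4), h.x_three_sq_mul_path] at key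
    simp only [mul_zero, neg_zero, zero_mul, sub_zero] at key
    simp only [src, tgt, component, mul_assoc] at key ⊢
    simpa using key.symm
  · have key := congr(a 1 * a 2 * a 3 * $(loop_word_one h.v4 hp hq) * (s 3 * s 2))
    rw [mul_neg, ← mul_assoc _ (_ ^ 2), h.path_three_sq, zero_mul, neg_zero, zero_mul, mul_sub,
      sub_mul, sub_eq_zero] at key
    have shift : s 3 * a 3 * (s 3 * s 2) = s 3 * s 2 * (s 1 * a 1) := by
      rw [← h.v2, ← mul_assoc, mul_assoc (s 3), h.v3]
      simp only [mul_assoc]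
    rw [← mul_assoc _ (_ * _ * _) (s 3 * a 3), mul_assoc _ (s 3 * a 3) (s 3 * s 2), shift] at key
    simpa [src, tgt, component, mul_assoc] using key
  · have key := congr(a 2 * a 3 * $(loop_word_two h.v4 hp hq) * s 3)
    rw [mul_neg, neg_mul, mul_assoc _ (_ * _ ^ 4), mul_assoc _ (_ ^ 4), h.x_three_pow_four_mul,
      mul_zero, mul_zero, neg_zero, mul_sub, sub_mul, sub_eq_zero] at key
    have shift : s 3 * a 3 * s 3 = s 3 * (s 2 * a 2) := by rw [mul_assoc, h.v3]
    rw [← mul_assoc _ _ (s 3 * a 3), mul_assoc _ (s 3 * a 3) (s 3), shift] at key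
    simpa [src, tgt, component, mul_assoc] using key
  · have key := congr(a 3 * $(loop_word_three h.v4 hp hq))
    rw [mul_neg, ← mul_assoc _ (_ ^ 4), h.a_three_pow_four, zero_mul, neg_zero, mul_sub,
      sub_eq_zero] at key
    simpa [src, tgt, component, mul_assoc] using key
  · have key := congr(a 4 * $(loop_word_four h.v4 hp hq))
    rw [h5, mul_zero, zero_mul, zero_mul, sub_zero, sub_zero, add_zero,
      ← mul_assoc (a 4) (_ * _), h.a_four_sq, zero_mul, mul_add, add_eq_zero_iff_neg_eq] at key
    simpa [src, tgt, component, mul_assoc, pow_succ] using key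
  · have key := congr(a 5 * a 4 * $(loop_word_five h.v4 hp hq) * s 4)
    rw [h5, mul_sub, mul_sub, ← mul_assoc _ (s 4 * a 4) (_ + _), h.path_five, neg_zero, mul_zero,
      zero_mul, sub_zero, zero_sub, neg_mul, mul_assoc _ _ (s 4), mul_assoc _ _ (s 4),
      mul_assoc (s 6 * a 6 * (s 4 * a 4) * (s 6 * a 6)), h.x_four_sq_mul,
      mul_zero, mul_zero, neg_zero, add_mul, mul_add,
      add_eq_zero_iff_eq_neg] at key
    have shift : s 4 * a 4 * s 4 = s 4 * (s 5 * a 5) := by rw [mul_assoc, h.v5]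
    rw [mul_assoc _ (s 4 * a 4) (s 4), shift] at key
    simpa [src, tgt, component, mul_assoc] using key
  · have key := congr(a 6 * $(loop_word_six h.v4 hp hq))
    rw [h5, zero_mul, sub_zero, ← mul_assoc (a 6) (_ * _), h.a_six_x, zero_mul, mul_add,
      add_eq_zero_iff_neg_eq] at key
    simpa [src, tgt, component, mul_assoc, pow_succ] using key

theorem star_mul_component (h : VertexRelations a s) (i : Fin 7) :
    s i * component a s (src i) = component a s (tgt i) * s i := by
  apply op_injective
  simpa only [component_op, op_mul] using h.op.component_mul_arrow i

end VertexRelations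

/-- The trivial path at the vertex `v` in `Π(E₈)`. -/
noncomputable def idem (v : Fin 8) : PiE8 := RingQuot.mkAlgHom ℂ Rel (E v)

theorem idem_mul_idem (v w : Fin 8) : idem v * idem w = if v = w then idem v else 0 := by
  have := RingQuot.mkAlgHom_rel ℂ (Rel.orth v w)
  rw [map_mul] at this
  rw [idem, idem, this]
  split_ifs <;> simp

theorem idem_src_mul_pa (i : Fin 7) : idem (src i) * pa i = pa i := by
  exact (map_mul _ _ _).symm.trans (RingQuot.mkAlgHom_rel ℂ (Rel.arrow_left i))

theorem pa_mul_idem_tgt (i : Fin 7) : pa i * idem (tgt i) = pa i := by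
  exact (map_mul _ _ _).symm.trans (RingQuot.mkAlgHom_rel ℂ (Rel.arrow_right i))

theorem idem_tgt_mul_ps (i : Fin 7) : idem (tgt i) * ps i = ps i := by
  exact (map_mul _ _ _).symm.trans (RingQuot.mkAlgHom_rel ℂ (Rel.star_left i))

theorem ps_mul_idem_src (i : Fin 7) : ps i * idem (src i) = ps i := by
  exact (map_mul _ _ _).symm.trans (RingQuot.mkAlgHom_rel ℂ (Rel.star_right i))

theorem idem_mul_pa (v : Fin 8) (i : Fin 7) :
    idem v * pa i = if v = src i then pa i else 0 := by
  rw [← idem_src_mul_pa i, ← mul_assoc, idem_mul_idem]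
  split_ifs with h <;> simp [h]

theorem idem_mul_ps (v : Fin 8) (i : Fin 7) :
    idem v * ps i = if v = tgt i then ps i else 0 := by
  rw [← idem_tgt_mul_ps i, ← mul_assoc, idem_mul_idem]
  split_ifs with h <;> simp [h]

theorem idem_mul_preproj (v : Fin 8) :
    ∑ i, ((if v = src i then pa i * ps i else 0) - if v = tgt i then ps i * pa i else 0) = 0 := by
  have h : ∑ i, (pa i * ps i - ps i * pa i) = 0 := by
    simpa only [pa, ps, map_sum, map_sub, map_mul, map_zero] using
      RingQuot.mkAlgHom_rel ℂ Rel.preproj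
  have := congr(idem v * $h)
  simpa only [Finset.mul_sum, mul_sub, ← mul_assoc, idem_mul_pa, idem_mul_ps, ite_mul, zero_mul,
    mul_zero] using this

theorem vertexRelations : VertexRelations pa ps where
  v0 := by simpa [Fin.sum_univ_seven, src, tgt] using idem_mul_preproj 0
  v1 := by
    simpa [Fin.sum_univ_seven, src, tgt, neg_add_eq_sub, sub_eq_zero] using idem_mul_preproj 1
  v2 := by
    simpa [Fin.sum_univ_seven, src, tgt, neg_add_eq_sub, sub_eq_zero] using idem_mul_preproj 2
  v3 := by
    simpa [Fin.sum_univ_seven, src, tgt, neg_add_eq_sub, sub_eq_zero] using idem_mul_preproj 3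
  v4 := by
    have := idem_mul_preproj 4
    simp [Fin.sum_univ_seven, src, tgt] at this
    rw [← sub_eq_zero, ← neg_eq_zero, ← this]
    abel
  v5 := by
    simpa [Fin.sum_univ_seven, src, tgt, sub_eq_zero] using idem_mul_preproj 5
  v6 := by simpa [Fin.sum_univ_seven, src, tgt] using idem_mul_preproj 6
  v7 := by simpa [Fin.sum_univ_seven, src, tgt] using idem_mul_preproj 7

theorem z12_eq_sum_component : z12 = ∑ v, component pa ps v := by
  simp only [z12, px, component, Fin.sum_univ_eight]
  simp [sub_eq_add_neg]

theorem idem_mul_component (v : Fin 8) : idem v * component pa ps v = component pa ps v :=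
  mul_component idem_src_mul_pa idem_tgt_mul_ps v

theorem component_mul_idem (v : Fin 8) : component pa ps v * idem v = component pa ps v :=
  component_mul ps_mul_idem_src pa_mul_idem_tgt v

theorem z12_mul_idem (v : Fin 8) : z12 * idem v = component pa ps v := by
  rw [z12_eq_sum_component, Finset.sum_mul, Finset.sum_eq_single v, component_mul_idem]
  · intro w _ hw
    rw [← component_mul_idem, mul_assoc, idem_mul_idem, if_neg hw, mul_zero]
  · simp

theorem idem_mul_z12 (v : Fin 8) : idem v * z12 = component pa ps v := by
  rw [z12_eq_sum_component, Finset.mul_sum, Finset.sum_eq_single v, idem_mul_component]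
  · intro w _ hw
    rw [← idem_mul_component, ← mul_assoc, idem_mul_idem, if_neg hw.symm, zero_mul]
  · simp

theorem commute_z12_pa (i : Fin 7) : Commute z12 (pa i) := by
  have h := vertexRelations.component_mul_arrow i
  rwa [← z12_mul_idem, mul_assoc, idem_src_mul_pa, ← idem_mul_z12, ← mul_assoc,
    pa_mul_idem_tgt] at h

theorem commute_z12_ps (i : Fin 7) : Commute z12 (ps i) := by
  have h := vertexRelations.star_mul_component i
  rw [← idem_mul_z12, ← mul_assoc, ps_mul_idem_src, ← z12_mul_idem, mul_assoc,
    idem_tgt_mul_ps] at h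
  exact h.symm

end E8

/-- The element `z₁₂` lies in the center of the preprojective algebra `Π(E₈)`. -/
theorem z12_mem_center : ∀ y : PiE8, z12 * y = y * z12 := by
  intro y
  obtain ⟨w, rfl⟩ := RingQuot.mkAlgHom_surjective ℂ E8.Rel y
  change Commute z12 _
  induction w using FreeAlgebra.induction with
  | grade0 c => exact ((RingQuot.mkAlgHom ℂ E8.Rel).commutes c).symm ▸ (Algebra.commutes c z12).symm
  | grade1 g =>
    cases g with
    | e v => exact (E8.z12_mul_idem v).trans (E8.idem_mul_z12 v).symm
    | a i => exact E8.commute_z12_pa i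
    | astar i => exact E8.commute_z12_ps i
  | mul u v hu hv => simpa only [map_mul] using hu.mul_right hv
  | add u v hu hv => simpa only [map_add] using hu.add_right hv
end

section
/- In the preprojective algebra Π(E_8), the element z_20 = −a_1a_2a_3x_4^2x_3^3x_4^2a_3^*a_2^*a_1^* − a_2a_3(x_6x_4)^2(x_4x_6)^2a_3^*a_2^* + a_3(x_6x_4)^4x_6a_3^* − (x_4x_6)^5 + (x_6x_4^2)^3x_6 − (x_6x_4)^5 − a_4(x_4x_6x_4)^3a_4^* − a_6(x_4x_6)^4x_4a_6^* lies in the center of Π(E_8), i.e. z_20·y = y·z_20 for all y ∈ Π(E_8). -/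
namespace E8

section Words

variable {R : Type*} [Ring R] {x y u v : R}

theorem mul_mul_mul_eq_zero (h : x * (x * x) = 0) (t : R) : x * (x * (x * t)) = 0 := by
  simpa only [mul_assoc, zero_mul] using congrArg (· * t) h

theorem mul_mul_eq_zero (h : x * y = 0) (t : R) : x * (y * t) = 0 := by
  rw [← mul_assoc, h, zero_mul]

/-- The relation `(x + y) ^ 5 = 0`, expanded modulo `x ^ 3 = y ^ 2 = 0`. -/
theorem words_five (hx : x * (x * x) = 0) (hy : y * y = 0) (h : (x + y) ^ 5 = 0) :
    x * x * y * x * x + x * x * y * x * y + x * y * x * x * y + x * y * x * y * x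
      + y * x * x * y * x + y * x * y * x * x + y * x * y * x * y = 0 := by
  rw [← h]
  simp only [pow_succ, pow_zero, one_mul, mul_add, add_mul, mul_assoc, hx, hy, mul_zero, add_zero,
    zero_add]
  abel

/-- The identity behind `z₂₀` commuting with `a₀`, with `x = x₄`, `y = x₆`. -/
theorem word_identity_arrow_zero (hx : x * (x * x) = 0) (hy : y * y = 0) (h : (x + y) ^ 5 = 0)
    (hu : u * (x + y) = 0) (hv : (x + y) ^ 2 * v = 0) :
    u * (x ^ 2 * (x + y) ^ 3 * x ^ 2) * v = 0 := by
  have e₁ := congrArg (u * x * · * y * v) (words_five hx hy h)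
  have e₂ := congrArg (· * (y * x * y * x * x * y * v + y * x * x * y * x * y * v)) hu
  have e₃ := congrArg (u * x * x * y * x * y * ·) hv
  simp only [pow_succ, pow_zero, one_mul, mul_add, add_mul, mul_assoc, hx, hy, mul_mul_mul_eq_zero hx,
    mul_mul_eq_zero hy, mul_zero, add_zero, zero_add, zero_mul] at e₁ e₂ e₃ ⊢
  linear_combination (norm := abel) e₂ + e₃ - e₁

/-- The identity behind `z₂₀` commuting with `a₁`, with `x = x₄`, `y = x₆`. -/
theorem word_identity_arrow_one (hx : x * (x * x) = 0) (hy : y * y = 0) (h : (x + y) ^ 5 = 0)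
    (hu : u * (x + y) ^ 2 = 0) :
    u * (x ^ 2 * (x + y) ^ 3 * x ^ 2 * (x + y)) = u * ((y * x) ^ 2 * (x * y) ^ 2) := by
  have e₁ := congrArg (u * x * x * · * y) (words_five hx hy h)
  have e₂ := congrArg (· * (y * x * x * y * x * y)) hu
  simp only [pow_succ, pow_zero, one_mul, mul_add, add_mul, mul_assoc, hx, hy, mul_mul_mul_eq_zero hx,
    mul_mul_eq_zero hy, mul_zero, add_zero, zero_add, zero_mul] at e₁ e₂ ⊢
  linear_combination (norm := abel) e₁ - e₂

/-- The identity behind `z₂₀` commuting with `a₂`, with `x = x₄`, `y = x₆`. -/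
theorem word_identity_arrow_two (hx : x * (x * x) = 0) (hy : y * y = 0) (h : (x + y) ^ 5 = 0)
    (hv : (x + y) ^ 4 * v = 0) :
    u * ((y * x) ^ 2 * (x * y) ^ 2 * (x + y)) * v = u * ((y * x) ^ 4 * y) * v := by
  have e₁ := congrArg (u * y * x * y * · * y * v) (words_five hx hy h)
  have e₂ := congrArg (u * y * x * y * x * x * ·) hv
  simp only [pow_succ, pow_zero, one_mul, mul_add, add_mul, mul_assoc, hx, hy, mul_mul_mul_eq_zero hx,
    mul_mul_eq_zero hy, mul_zero, add_zero, zero_add, zero_mul] at e₁ e₂ ⊢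
  linear_combination (norm := abel) e₂ - e₁

/-- The identity behind `z₂₀` commuting with `a₃`, with `x = x₄`, `y = x₆`. -/
theorem word_identity_arrow_three (hx : x * (x * x) = 0) (hy : y * y = 0) (h : (x + y) ^ 5 = 0)
    (hu : u * (x + y) ^ 4 = 0) : u * (x * y) ^ 5 = u * ((y * x ^ 2) ^ 3 * y) := by
  have e₁ := congrArg (u * x * y * x * y * · * y) (words_five hx hy h)
  have e₂ := congrArg (· * (x * x * y * x * x * y)) hu
  simp only [pow_succ, pow_zero, one_mul, mul_add, add_mul, mul_assoc, hx, hy, mul_mul_mul_eq_zero hx,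
    mul_mul_eq_zero hy, mul_zero, add_zero, zero_add, zero_mul] at e₁ e₂ ⊢
  linear_combination (norm := abel) e₁ - e₂

/-- The identity behind `z₂₀` commuting with `a₄`, with `x = x₄`, `y = x₆`. -/
theorem word_identity_arrow_four (hx : x * (x * x) = 0) (hy : y * y = 0) (h : (x + y) ^ 5 = 0)
    (hu : u * (x * x) = 0) :
    u * ((x * y * x) ^ 3 * x) = u * ((x * y) ^ 5 - (y * x ^ 2) ^ 3 * y + (y * x) ^ 5) := by
  have hu' (t : R) : u * (x * (x * t)) = 0 := by
    simpa only [mul_assoc, zero_mul] using congrArg (· * t) hu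
  have e₁ := congrArg (u * · * (x * x * y * x * x - y * x * y * x * y)) (words_five hx hy h)
  have e₂ := congrArg (u * (y * x * x + y * x * y) * · * (x * y)) (words_five hx hy h)
  have e₃ := congrArg (u * y * x * y * x * y * ·) (words_five hx hy h)
  simp only [pow_succ, pow_zero, one_mul, mul_add, add_mul, mul_sub, mul_assoc, hu',
    mul_mul_mul_eq_zero hx, mul_mul_eq_zero hy, mul_zero, add_zero, zero_add, zero_mul, sub_zero] at e₁ e₂ e₃ ⊢
  linear_combination (norm := abel) e₁ + e₂ - e₃

end Words

/-- The path relations and the preprojective relation of `Π(E₈)` in an arbitrary ring. -/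
structure PreprojRelations {R : Type*} [Ring R] (e : Fin 8 → R) (a s : Fin 7 → R) : Prop where
  orth : ∀ i j, e i * e j = if i = j then e i else 0
  arrow_left : ∀ i, e (src i) * a i = a i
  arrow_right : ∀ i, a i * e (tgt i) = a i
  star_left : ∀ i, e (tgt i) * s i = s i
  star_right : ∀ i, s i * e (src i) = s i
  preproj : ∑ i, (a i * s i - s i * a i) = 0

/-- The component of `z₂₀` at each vertex. -/
def vertexLoop {R : Type*} [Ring R] (a s : Fin 7 → R) : Fin 8 → R :=
  ![0,
    -(a 1 * a 2 * a 3 * (s 4 * a 4) ^ 2 * (s 3 * a 3) ^ 3 * (s 4 * a 4) ^ 2 * s 3 * s 2 * s 1),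
    -(a 2 * a 3 * (s 6 * a 6 * (s 4 * a 4)) ^ 2 * (s 4 * a 4 * (s 6 * a 6)) ^ 2 * s 3 * s 2),
    a 3 * (s 6 * a 6 * (s 4 * a 4)) ^ 4 * (s 6 * a 6) * s 3,
    -(s 4 * a 4 * (s 6 * a 6)) ^ 5 + (s 6 * a 6 * (s 4 * a 4) ^ 2) ^ 3 * (s 6 * a 6)
      - (s 6 * a 6 * (s 4 * a 4)) ^ 5,
    -(a 4 * (s 4 * a 4 * (s 6 * a 6) * (s 4 * a 4)) ^ 3 * s 4),
    0,
    -(a 6 * (s 4 * a 4 * (s 6 * a 6)) ^ 4 * (s 4 * a 4) * s 6)]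

open MulOpposite in
theorem vertexLoop_op {R : Type*} [Ring R] (a s : Fin 7 → R) (i : Fin 8) :
    vertexLoop (fun i => op (s i)) (fun i => op (a i)) i = op (vertexLoop a s i) := by
  apply unop_injective
  fin_cases i <;> simp [vertexLoop, pow_succ, mul_assoc]
  abel

namespace PreprojRelations

variable {R : Type*} [Ring R] {e : Fin 8 → R} {a s : Fin 7 → R}

open MulOpposite in
theorem op (h : PreprojRelations e a s) :
    PreprojRelations (fun i => op (e i)) (fun i => op (s i)) (fun i => op (a i)) where
  orth i j := by
    rw [← op_mul, h.orth]
    by_cases hij : i = j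
    · simp [hij]
    · simp [hij, Ne.symm hij]
  arrow_left i := congrArg MulOpposite.op (h.star_right i)
  arrow_right i := congrArg MulOpposite.op (h.star_left i)
  star_left i := congrArg MulOpposite.op (h.arrow_right i)
  star_right i := congrArg MulOpposite.op (h.arrow_left i)
  preproj := by
    apply unop_injective
    simpa using h.preproj

theorem vertex_mul_arrow (h : PreprojRelations e a s) (v : Fin 8) (i : Fin 7) :
    e v * a i = if v = src i then a i else 0 := by
  rw [← h.arrow_left i, ← mul_assoc, h.orth]
  split_ifs with hv <;> simp [hv]

theorem vertex_mul_star (h : PreprojRelations e a s) (v : Fin 8) (i : Fin 7) :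
    e v * s i = if v = tgt i then s i else 0 := by
  rw [← h.star_left i, ← mul_assoc, h.orth]
  split_ifs with hv <;> simp [hv]

/-- The preprojective relation at the vertex `v`. -/
theorem preproj_at (h : PreprojRelations e a s) (v : Fin 8) :
    ∑ i, ((if v = src i then a i * s i else 0) - if v = tgt i then s i * a i else 0) = 0 := by
  have hv := congrArg (e v * ·) h.preproj
  simp only [Finset.mul_sum, mul_zero] at hv
  refine (Finset.sum_congr rfl fun i _ => ?_).trans hv
  rw [mul_sub, ← mul_assoc, ← mul_assoc, h.vertex_mul_arrow, h.vertex_mul_star]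
  split_ifs <;> simp

theorem vertex_mul_vertexLoop (h : PreprojRelations e a s) (v : Fin 8) :
    e v * vertexLoop a s v = vertexLoop a s v := by
  have ha (v i t) : e v * (a i * t) = if v = src i then a i * t else 0 := by
    rw [← mul_assoc, h.vertex_mul_arrow, ite_mul, zero_mul]
  have hs (v i t) : e v * (s i * t) = if v = tgt i then s i * t else 0 := by
    rw [← mul_assoc, h.vertex_mul_star, ite_mul, zero_mul]
  fin_cases v <;>
    simp [vertexLoop, pow_succ', mul_assoc, mul_add, mul_sub, ha, hs, src, tgt]

theorem vertexLoop_mul_vertex (h : PreprojRelations e a s) (v : Fin 8) :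
    vertexLoop a s v * e v = vertexLoop a s v := by
  apply MulOpposite.op_injective
  rw [MulOpposite.op_mul, ← vertexLoop_op]
  exact h.op.vertex_mul_vertexLoop v

theorem vertex_mul_sum (h : PreprojRelations e a s) (v : Fin 8) :
    e v * ∑ w, vertexLoop a s w = vertexLoop a s v := by
  rw [Finset.mul_sum, Finset.sum_eq_single v, h.vertex_mul_vertexLoop]
  · intro w _ hw
    rw [← h.vertex_mul_vertexLoop, ← mul_assoc, h.orth, if_neg hw.symm, zero_mul]
  · simp

theorem sum_mul_vertex (h : PreprojRelations e a s) (v : Fin 8) :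
    (∑ w, vertexLoop a s w) * e v = vertexLoop a s v := by
  rw [Finset.sum_mul, Finset.sum_eq_single v, h.vertexLoop_mul_vertex]
  · intro w _ hw
    rw [← h.vertexLoop_mul_vertex, mul_assoc, h.orth, if_neg hw, mul_zero]
  · simp

theorem vertexLoop_mul_arrow (h : PreprojRelations e a s) (i : Fin 7) :
    vertexLoop a s (src i) * a i = a i * vertexLoop a s (tgt i) := by
  have r₀ : a 0 * s 0 = 0 := by
    simpa [Fin.sum_univ_seven, src, tgt] using h.preproj_at 0
  have r₁ : a 1 * s 1 = s 0 * a 0 := by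
    simpa [Fin.sum_univ_seven, src, tgt, ← sub_eq_neg_add, sub_eq_zero] using h.preproj_at 1
  have r₂ : a 2 * s 2 = s 1 * a 1 := by
    simpa [Fin.sum_univ_seven, src, tgt, ← sub_eq_neg_add, sub_eq_zero] using h.preproj_at 2
  have r₃ : a 3 * s 3 = s 2 * a 2 := by
    simpa [Fin.sum_univ_seven, src, tgt, ← sub_eq_neg_add, sub_eq_zero] using h.preproj_at 3
  have r₄ : a 4 * s 4 = s 5 * a 5 := by
    simpa [Fin.sum_univ_seven, src, tgt, sub_eq_zero] using h.preproj_at 5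
  have r₅ : a 5 * s 5 = 0 := by
    simpa [Fin.sum_univ_seven, src, tgt] using h.preproj_at 6
  have r₆ : a 6 * s 6 = 0 := by
    simpa [Fin.sum_univ_seven, src, tgt] using h.preproj_at 7
  have r₇ : s 3 * a 3 = -(s 4 * a 4 + s 6 * a 6) := by
    rw [eq_neg_iff_add_eq_zero, ← neg_eq_zero, ← h.preproj_at 4]
    simp [Fin.sum_univ_seven, src, tgt]
    abel
  have assoc {p q r t : R} (h : p * q = r * t) (m : R) : p * (q * m) = r * (t * m) := by
    rw [← mul_assoc, h, mul_assoc]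
  have q₀ := mul_mul_eq_zero r₀
  have q₁ := assoc r₁
  have q₂ := assoc r₂
  have q₃ := assoc r₃
  have q₄ := assoc r₄
  have q₅ := mul_mul_eq_zero r₅
  obtain ⟨w, hw⟩ : ∃ w, s 3 * a 3 = -w := ⟨_, (neg_neg _).symm⟩
  obtain ⟨x, hx⟩ : ∃ x, s 4 * a 4 = x := ⟨_, rfl⟩
  obtain ⟨y, hy⟩ : ∃ y, s 6 * a 6 = y := ⟨_, rfl⟩
  have hw' : w = -(s 3 * a 3) := by rw [hw, neg_neg]
  have hxy : x + y = w := by rw [← hx, ← hy, hw', r₇, neg_neg]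
  have hx₃ : x * (x * x) = 0 := by
    simp only [← hx, mul_assoc, q₄, q₅, mul_zero]
  have hy₂ : y * y = 0 := by
    simp only [← hy, mul_assoc, mul_mul_eq_zero r₆, mul_zero]
  have hw₅ : (x + y) ^ 5 = 0 := by
    simp [hxy, hw', pow_succ, mul_assoc, q₀, q₁, q₂, q₃]
  have u₀ : a 0 * a 1 * a 2 * a 3 * (x + y) = 0 := by
    simp [hxy, hw', mul_assoc, q₀, q₁, q₂, q₃]
  have u₁ : a 1 * a 2 * a 3 * (x + y) ^ 2 = 0 := by
    simp [hxy, hw', pow_succ, mul_assoc, q₀, q₁, q₂, q₃]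
  have u₃ : a 3 * (x + y) ^ 4 = 0 := by
    simp [hxy, hw', pow_succ, mul_assoc, q₀, q₁, q₂, q₃]
  have u₄ : a 4 * (x * x) = 0 := by
    simp only [← hx, mul_assoc, q₄, q₅, mul_zero]
  have u₅ : a 5 * a 4 * x = 0 := by
    simp only [← hx, mul_assoc, q₄, q₅]
  have u₆ : a 6 * y = 0 := by
    rw [← hy, ← mul_assoc, r₆, zero_mul]
  have v₀ : (x + y) ^ 2 * (s 3 * s 2 * s 1) = 0 := by
    simp [hxy, hw', pow_succ, mul_assoc, r₁, q₀, q₁, q₂, q₃]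
  have v₂ : (x + y) ^ 4 * s 3 = 0 := by
    simp [hxy, hw', pow_succ, mul_assoc, r₃, q₀, q₁, q₂, q₃]
  have t₁ : s 3 * s 2 * s 1 * a 1 = -(x + y) * s 3 * s 2 := by
    simp [hxy, hw', mul_assoc, r₂, q₃]
  have t₂ : s 3 * s 2 * a 2 = -(x + y) * s 3 := by
    simp [hxy, hw', mul_assoc, r₃]
  rw [← hxy] at hw
  fin_cases i <;> simp only [vertexLoop, src, tgt, hx, hy, hw, Fin.zero_eta, Fin.mk_one,
    Fin.reduceFinMk, Matrix.cons_val]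
  · linear_combination (norm := noncomm_ring) -word_identity_arrow_zero hx₃ hy₂ hw₅ u₀ v₀
  · linear_combination (norm := noncomm_ring)
      -word_identity_arrow_one hx₃ hy₂ hw₅ u₁ * (s 3 * s 2)
        + a 1 * a 2 * a 3 * x ^ 2 * (x + y) ^ 3 * x ^ 2 * t₁
  · linear_combination (norm := noncomm_ring)
      word_identity_arrow_two (u := a 2 * a 3) hx₃ hy₂ hw₅ v₂
        - a 2 * a 3 * (y * x) ^ 2 * (x * y) ^ 2 * t₂
  · linear_combination (norm := noncomm_ring)
      word_identity_arrow_three hx₃ hy₂ hw₅ u₃ + a 3 * (y * x) ^ 4 * y * hw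
        - a 3 * (y * x) ^ 4 * hy₂
  · linear_combination (norm := noncomm_ring)
      -word_identity_arrow_four hx₃ hy₂ hw₅ u₄ - a 4 * (x * y * x) ^ 3 * hx
  · linear_combination (norm := noncomm_ring) u₅ * (y * x * (x * y * x) ^ 2 * s 4)
  · linear_combination (norm := noncomm_ring)
      u₆ * (x * (y * x) ^ 4) - u₆ * (x ^ 2 * (y * x ^ 2) ^ 2 * y) - a 6 * (x * y) ^ 4 * x * hy

theorem star_mul_vertexLoop (h : PreprojRelations e a s) (i : Fin 7) :
    vertexLoop a s (tgt i) * s i = s i * vertexLoop a s (src i) := by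
  apply MulOpposite.op_injective
  rw [MulOpposite.op_mul, MulOpposite.op_mul, ← vertexLoop_op, ← vertexLoop_op]
  exact (h.op.vertexLoop_mul_arrow i).symm

theorem sum_commute_vertex (h : PreprojRelations e a s) (v : Fin 8) :
    Commute (∑ w, vertexLoop a s w) (e v) :=
  (h.sum_mul_vertex v).trans (h.vertex_mul_sum v).symm

theorem sum_commute_arrow (h : PreprojRelations e a s) (i : Fin 7) :
    Commute (∑ w, vertexLoop a s w) (a i) := by
  rw [Commute, SemiconjBy]
  nth_rw 1 [← h.arrow_left i]
  nth_rw 2 [← h.arrow_right i]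
  rw [← mul_assoc, h.sum_mul_vertex, h.vertexLoop_mul_arrow, mul_assoc, h.vertex_mul_sum]

theorem sum_commute_star (h : PreprojRelations e a s) (i : Fin 7) :
    Commute (∑ w, vertexLoop a s w) (s i) := by
  rw [Commute, SemiconjBy]
  nth_rw 1 [← h.star_left i]
  nth_rw 2 [← h.star_right i]
  rw [← mul_assoc, h.sum_mul_vertex, h.star_mul_vertexLoop, mul_assoc, h.vertex_mul_sum]

end PreprojRelations

theorem preprojRelations_piE8 :
    PreprojRelations (fun i => RingQuot.mkAlgHom ℂ Rel (E i)) pa ps where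
  orth i j := by
    rw [← map_mul, RingQuot.mkAlgHom_rel ℂ (Rel.orth i j)]
    split_ifs <;> simp
  arrow_left i := by
    rw [pa, ← map_mul, RingQuot.mkAlgHom_rel ℂ (Rel.arrow_left i)]
  arrow_right i := by
    rw [pa, ← map_mul, RingQuot.mkAlgHom_rel ℂ (Rel.arrow_right i)]
  star_left i := by
    rw [ps, ← map_mul, RingQuot.mkAlgHom_rel ℂ (Rel.star_left i)]
  star_right i := by
    rw [ps, ← map_mul, RingQuot.mkAlgHom_rel ℂ (Rel.star_right i)]
  preproj := by
    simpa [pa, ps] using RingQuot.mkAlgHom_rel ℂ Rel.preproj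

theorem z20_eq_sum : z20 = ∑ v, vertexLoop pa ps v := by
  simp only [Fin.sum_univ_eight, vertexLoop, z20, px, Matrix.cons_val]
  abel

end E8

/-- The element `z₂₀` lies in the center of the preprojective algebra `Π(E₈)`. -/
theorem z20_mem_center : ∀ y : PiE8, z20 * y = y * z20 := by
  intro y
  obtain ⟨y, rfl⟩ := RingQuot.mkAlgHom_surjective ℂ E8.Rel y
  have h := E8.preprojRelations_piE8
  rw [E8.z20_eq_sum]
  change Commute _ _
  induction y using FreeAlgebra.induction with
  | grade0 r =>
    rw [AlgHom.commutes]
    exact Algebra.commute_algebraMap_right r _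
  | grade1 g =>
    cases g with
    | e v => exact h.sum_commute_vertex v
    | a i => exact h.sum_commute_arrow i
    | astar i => exact h.sum_commute_star i
  | mul p q hp hq =>
    rw [map_mul]
    exact hp.mul_right hq
  | add p q hp hq =>
    rw [map_add]
    exact hp.add_right hq
end
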